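/- Let X be a finite indecomposable square-free q-cycle set. Then the operations · and : on every iterated retraction Ret^k(X) do not coincide for any k ≥ 0; in particular X is not multipermutational. -/

import Mathlib

/-- The iterated retract relation of a regular q-cycle set: x ~_0 y iff x = y, and
x ~_{k+1} y iff the classes of x and y have equal left multiplications on Ret^k(X). -/
def qcsRel {X : Type*} (σ δ : X → Equiv.Perm X) : ℕ → X → X → Prop
  | 0, x, y => x = y
  | k + 1, x, y => ∀ z : X, qcsRel σ δ k (σ x z) (σ y z) ∧ qcsRel σ δ k (δ x z) (δ y z)

theorem Subgroup.relIndex_eq_ncard_orbit {G : Type*} [Group G] (H K : Subgroup G) :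
    K.relIndex H = (MulAction.orbit H ((1 : G) : G ⧸ K)).ncard := by
  have hstab : MulAction.stabilizer H ((1 : G) : G ⧸ K) = K.subgroupOf H := by
    ext x
    rw [MulAction.mem_stabilizer_iff, Subgroup.mem_subgroupOf]
    change (((x : G) * 1 : G) : G ⧸ K) = _ ↔ _
    rw [mul_one, eq_comm, QuotientGroup.eq, inv_one, one_mul]
  rw [← MulAction.index_stabilizer, hstab, relIndex]

theorem Subgroup.index_eq_relIndex_iff_forall_exists_mul_eq {G : Type*} [Group G] [Finite G]
    {H K : Subgroup G} :
    K.index = K.relIndex H ↔ ∀ g : G, ∃ x ∈ H, ∃ y ∈ K, x * y = g := by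
  have horb : K.index = K.relIndex H ↔ MulAction.orbit H ((1 : G) : G ⧸ K) = Set.univ := by
    rw [relIndex_eq_ncard_orbit, index_eq_card, ← Set.ncard_univ]
    exact ⟨fun h => Set.eq_of_subset_of_ncard_le (Set.subset_univ _) h.le, fun h => by rw [h]⟩
  rw [horb, Set.eq_univ_iff_forall]
  constructor
  · intro h g
    obtain ⟨x, hx⟩ := h g
    change (((x : G) * 1 : G) : G ⧸ K) = g at hx
    rw [mul_one, QuotientGroup.eq] at hx
    exact ⟨x, x.2, _, hx, mul_inv_cancel_left _ _⟩
  · rintro h ⟨g⟩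
    obtain ⟨x, hx, y, hy, rfl⟩ := h g
    refine ⟨⟨x, hx⟩, ?_⟩
    change ((x * 1 : G) : G ⧸ K) = ((x * y : G) : G ⧸ K)
    rw [mul_one, QuotientGroup.eq, inv_mul_cancel_left]
    exact hy

theorem Subgroup.exists_mul_eq_of_coprime_index {G : Type*} [Group G] [Finite G]
    {H K : Subgroup G} (h : Nat.Coprime H.index K.index) (g : G) :
    ∃ x ∈ H, ∃ y ∈ K, x * y = g := by
  have h1 : K.relIndex H * H.index = H.relIndex K * K.index := by
    rw [← inf_relIndex_left H K, ← inf_relIndex_right H K,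
      relIndex_mul_index inf_le_left, relIndex_mul_index inf_le_right]
  have hdvd : K.index ∣ K.relIndex H :=
    h.symm.dvd_of_dvd_mul_right ⟨H.relIndex K, by rw [h1, mul_comm]⟩
  refine index_eq_relIndex_iff_forall_exists_mul_eq.1 (le_antisymm ?_ ?_) g
  · exact Nat.le_of_dvd (Nat.pos_of_ne_zero index_ne_zero_of_finite) hdvd
  · rw [relIndex_eq_ncard_orbit, index_eq_card, ← Set.ncard_univ]
    exact Set.ncard_le_ncard (Set.subset_univ _)

theorem Group.IsSolvable.exists_normal_isPGroup (G : Type*) [Group G] [Finite G] [Nontrivial G]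
    [Group.IsSolvable G] :
    ∃ p : ℕ, p.Prime ∧ ∃ N : Subgroup G, N.Normal ∧ N ≠ ⊥ ∧ IsPGroup p N := by
  classical
  have hs : ∃ n, derivedSeries G n = ⊥ := Group.IsSolvable.solvable
  obtain ⟨n, hn⟩ : ∃ n, Nat.find hs = n + 1 := by
    refine Nat.exists_eq_succ_of_ne_zero fun h0 => ?_
    have := Nat.find_spec hs
    rw [h0, derivedSeries_zero] at this
    exact top_ne_bot this
  set D := derivedSeries G n with hD
  have hDb : D ≠ ⊥ := Nat.find_min hs (by omega)
  have hcomm : ⁅D, D⁆ = ⊥ := by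
    have := Nat.find_spec hs
    rwa [hn, derivedSeries_succ] at this
  have hDc : ∀ a b : D, a * b = b * a := by
    intro a b
    have h := Subgroup.commutator_mem_commutator a.2 b.2
    rw [hcomm, Subgroup.mem_bot, commutatorElement_eq_one_iff_mul_comm] at h
    exact Subtype.ext h
  have : Nontrivial D := (Subgroup.nontrivial_iff_ne_bot D).2 hDb
  have hp : (Nat.card D).minFac.Prime := Nat.minFac_prime (Finite.one_lt_card).ne'
  have : Fact (Nat.card D).minFac.Prime := ⟨hp⟩
  let P : Sylow (Nat.card D).minFac D := default
  have hPn : (P : Subgroup D).Normal := ⟨fun a ha g => by rwa [hDc g a, mul_inv_cancel_right]⟩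
  have := P.characteristic_of_normal hPn
  refine ⟨_, hp, (P : Subgroup D).map D.subtype, inferInstance, ?_, P.2.map _⟩
  rw [Ne, Subgroup.map_eq_bot_iff_of_injective _ D.subtype_injective]
  exact P.ne_bot_of_dvd_card (Nat.minFac_dvd _)

theorem Group.isSolvable_of_coprime_index {G : Type*} [Group G] [Finite G] (H : Fin 3 → Subgroup G)
    (hs : ∀ i, Group.IsSolvable (H i))
    (hc : Pairwise fun i j => Nat.Coprime (H i).index (H j).index) : Group.IsSolvable G := by
  induction h : Nat.card G using Nat.strong_induction_on generalizing G with
  | _ n ih =>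
  subst h
  by_cases h0 : H 0 = ⊥
  · have h1 : (H 1).index = 1 := by
      have h01 : Nat.Coprime (H 0).index (H 1).index := hc (by decide)
      rw [h0, Subgroup.index_bot] at h01
      exact Nat.eq_one_of_dvd_coprimes h01 (H 1).index_dvd_card dvd_rfl
    rw [Subgroup.index_eq_one] at h1
    have := hs 1
    rw [h1] at this
    exact Group.isSolvable_of_surjective (f := (⊤ : Subgroup G).subtype)
      fun g => ⟨⟨g, trivial⟩, rfl⟩
  have := (Subgroup.nontrivial_iff_ne_bot _).2 h0
  have := hs 0
  obtain ⟨p, hp, N, hN, hNb, hNp⟩ := Group.IsSolvable.exists_normal_isPGroup (H 0)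
  have : Fact p.Prime := ⟨hp⟩
  obtain ⟨i, hi0, hi⟩ : ∃ i : Fin 3, i ≠ 0 ∧ ¬ p ∣ (H i).index := by
    by_contra! hall
    exact Nat.Prime.not_coprime_iff_dvd.2 ⟨p, hp, hall 1 (by decide), hall 2 (by decide)⟩
      (hc (by decide))
  let N' := N.map (H 0).subtype
  have hN'p : IsPGroup p N' := hNp.map _
  have hN'b : N' ≠ ⊥ := by
    rwa [Ne, Subgroup.map_eq_bot_iff_of_injective _ (H 0).subtype_injective]
  have hN'n : ∀ h ∈ H 0, ∀ a ∈ N', h * a * h⁻¹ ∈ N' := by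
    rintro h hh _ ⟨a, ha, rfl⟩
    exact ⟨_, hN.conj_mem a ha ⟨h, hh⟩, rfl⟩
  obtain ⟨c, hcfix⟩ := hN'p.nonempty_fixed_point_of_prime_not_dvd_card (G ⧸ H i)
    (by rwa [← Subgroup.index_eq_card])
  obtain ⟨g, rfl⟩ := QuotientGroup.mk_surjective c
  have hle1 : ∀ a ∈ N', g⁻¹ * a * g ∈ H i := by
    intro a ha
    have := hcfix ⟨a, ha⟩
    have h2 : ((a * g : G) : G ⧸ H i) = g := this
    have := QuotientGroup.eq.1 h2.symm
    rwa [← mul_assoc] at this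
  have hle : ∀ g : G, ∀ a ∈ N', g⁻¹ * a * g ∈ H i := by
    intro t a ha
    obtain ⟨x, hx, y, hy, hxy⟩ := Subgroup.exists_mul_eq_of_coprime_index (hc hi0.symm) g
    obtain ⟨u, hu, v, hv, huv⟩ := Subgroup.exists_mul_eq_of_coprime_index (hc hi0.symm) t
    have h1 := hle1 _ (hN'n x hx _ (hN'n _ (inv_mem hu) a ha))
    have h2 : t⁻¹ * a * t = (v⁻¹ * y) *
        (g⁻¹ * (x * (u⁻¹ * a * u⁻¹⁻¹) * x⁻¹) * g) * (v⁻¹ * y)⁻¹ := by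
      rw [← hxy, ← huv]; group
    rw [h2]
    exact mul_mem (mul_mem (mul_mem (inv_mem hv) hy) h1) (inv_mem (mul_mem (inv_mem hv) hy))
  let M := Subgroup.normalClosure (N' : Set G)
  have hMle : M ≤ H i := by
    refine (Subgroup.closure_le _).2 fun b hb => ?_
    obtain ⟨a, ha, hab⟩ := Group.mem_conjugatesOfSet_iff.1 hb
    obtain ⟨t, rfl⟩ := isConj_iff.1 hab
    simpa using hle t⁻¹ a ha
  have hMb : M ≠ ⊥ := fun hM => hN'b (le_bot_iff.1 (hM ▸ Subgroup.le_normalClosure))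
  have hMs : Group.IsSolvable M := by
    have := hs i
    exact Group.isSolvable_of_isSolvable_injective (Subgroup.inclusion_injective hMle)
  have hQ : Group.IsSolvable (G ⧸ M) := by
    refine ih (Nat.card (G ⧸ M)) ?_ (fun j => (H j).map (QuotientGroup.mk' M)) (fun j => ?_)
      (fun j k hjk => ?_) rfl
    · rw [← Subgroup.index_eq_card, ← M.card_mul_index]
      have := (Subgroup.one_lt_card_iff_ne_bot M).2 hMb
      exact lt_mul_of_one_lt_left (Nat.pos_of_ne_zero M.index_ne_zero_of_finite) this
    · have := hs j
      exact Group.isSolvable_of_surjective ((QuotientGroup.mk' M).subgroupMap_surjective (H j))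
    · exact Nat.Coprime.of_dvd
        (Subgroup.index_map_dvd _ (QuotientGroup.mk'_surjective M))
        (Subgroup.index_map_dvd _ (QuotientGroup.mk'_surjective M)) (hc hjk)
  exact (Group.isSolvable_iff_subgroup_quotient M).2 ⟨hMs, hQ⟩

theorem Group.IsSolvable.exists_le_index_eq_prime_pow {G : Type*} [Group G] [Finite G]
    [Group.IsSolvable G] {H : Subgroup G} (hH : H ≠ ⊤) :
    ∃ K : Subgroup G, H ≤ K ∧ K ≠ ⊤ ∧ ∃ p n : ℕ, p.Prime ∧ K.index = p ^ n := by
  induction h : Nat.card G using Nat.strong_induction_on generalizing G with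
  | _ n ih =>
  subst h
  have : Nontrivial G := by
    by_contra hG
    rw [not_nontrivial_iff_subsingleton] at hG
    exact hH (Subsingleton.elim _ _)
  obtain ⟨p, hp, N, hN, hNb, hNp⟩ := Group.IsSolvable.exists_normal_isPGroup G
  by_cases hHN : H ⊔ N = ⊤
  · have : Fact p.Prime := ⟨hp⟩
    obtain ⟨k, hk⟩ := hNp.exists_card_eq
    have hNH : ∀ g : G, ∃ x ∈ N, ∃ y ∈ H, x * y = g := fun g =>
      Subgroup.mem_sup_of_normal_left.1 (by rw [sup_comm, hHN]; trivial)
    obtain ⟨m, -, hm⟩ := (Nat.dvd_prime_pow hp).1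
      (show H.index ∣ p ^ k by
        rw [← hk, Subgroup.index_eq_relIndex_iff_forall_exists_mul_eq.2 hNH]
        exact Subgroup.relIndex_dvd_card _ _)
    exact ⟨H, le_rfl, hH, p, m, hp, hm⟩
  · have hmap : H.map (QuotientGroup.mk' N) ≠ ⊤ := by
      intro hm
      apply hHN
      have := congrArg (Subgroup.comap (QuotientGroup.mk' N)) hm
      rwa [Subgroup.comap_map_eq, QuotientGroup.ker_mk', Subgroup.comap_top] at this
    obtain ⟨K, hHK, hK, q, m, hq, hm⟩ := ih (Nat.card (G ⧸ N)) (by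
      rw [← Subgroup.index_eq_card, ← N.card_mul_index]
      exact lt_mul_of_one_lt_left (Nat.pos_of_ne_zero N.index_ne_zero_of_finite)
        ((Subgroup.one_lt_card_iff_ne_bot N).2 hNb)) hmap rfl
    have hsurj := QuotientGroup.mk'_surjective N
    refine ⟨K.comap (QuotientGroup.mk' N), Subgroup.map_le_iff_le_comap.1 hHK, fun h => hK ?_,
      q, m, hq, by rw [Subgroup.index_comap_of_surjective _ hsurj, hm]⟩
    rw [← Subgroup.map_comap_eq_self_of_surjective hsurj K, h,
      Subgroup.map_top_of_surjective _ hsurj]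

/-- In a finite solvable group acting transitively on a nontrivial set, some Sylow subgroup is not
generated by its elements with a fixed point. -/
theorem Group.IsSolvable.exists_sylow_closure_fixed_lt {G X : Type*} [Group G] [Finite G]
    [Group.IsSolvable G] [MulAction G X] [MulAction.IsPretransitive G X] [Nontrivial X] :
    ∃ p : ℕ, p.Prime ∧ ∀ P : Sylow p G,
      ¬ (P : Subgroup G) ≤ Subgroup.closure {g | g ∈ P ∧ ∃ x : X, g • x = x} := by
  obtain ⟨x₀, x₁, hne⟩ := exists_pair_ne X
  have hH : MulAction.stabilizer G x₀ ≠ ⊤ := by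
    intro h
    obtain ⟨g, hg⟩ := MulAction.exists_smul_eq G x₀ x₁
    have : g ∈ MulAction.stabilizer G x₀ := h ▸ Subgroup.mem_top g
    exact hne (this.symm.trans hg)
  obtain ⟨K, hHK, hK, p, n, hp, hn⟩ := Group.IsSolvable.exists_le_index_eq_prime_pow hH
  have : Fact p.Prime := ⟨hp⟩
  refine ⟨p, hp, fun P hP => ?_⟩
  have hcop : Nat.Coprime (P : Subgroup G).index K.index := by
    rw [hn]
    exact ((Nat.Prime.coprime_iff_not_dvd hp).2 P.not_dvd_index).symm.pow_right n
  have hPK : K.subgroupOf P ≠ ⊤ := by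
    intro h
    rw [Subgroup.subgroupOf_eq_top] at h
    exact hK (Subgroup.index_eq_one.1
      (Nat.eq_one_of_dvd_coprimes hcop (Subgroup.index_dvd_of_le h) dvd_rfl))
  obtain ⟨M, hM, hKM⟩ := (eq_top_or_exists_le_coatom (K.subgroupOf P)).resolve_left hPK
  have : Group.IsNilpotent P := P.2.isNilpotent
  have hMn : M.Normal := Subgroup.NormalizerCondition.normal_of_coatom M
    Group.normalizerCondition_of_isNilpotent hM
  have hle : (P : Subgroup G) ≤ M.map (P : Subgroup G).subtype := by
    refine hP.trans ((Subgroup.closure_le _).2 ?_)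
    rintro g ⟨hgP, x, hx⟩
    obtain ⟨t, rfl⟩ := MulAction.exists_smul_eq G x₀ x
    obtain ⟨u, hu, k, hk, rfl⟩ := Subgroup.exists_mul_eq_of_coprime_index hcop t
    have h1 : (u * k)⁻¹ * g * (u * k) ∈ K := by
      apply hHK
      rw [MulAction.mem_stabilizer_iff, mul_smul, mul_smul, hx, inv_smul_smul]
    have h2 : u⁻¹ * g * u ∈ K := by
      have := mul_mem (mul_mem hk h1) (inv_mem hk)
      have e : k * ((u * k)⁻¹ * g * (u * k)) * k⁻¹ = u⁻¹ * g * u := by group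
      rwa [e] at this
    have h3 : (⟨u, hu⟩ : P)⁻¹ * ⟨g, hgP⟩ * ⟨u, hu⟩ ∈ M := hKM (Subgroup.mem_subgroupOf.2 h2)
    have h4 := hMn.conj_mem _ h3 ⟨u, hu⟩
    refine ⟨⟨g, hgP⟩, ?_, rfl⟩
    have e : (⟨u, hu⟩ : P) * ((⟨u, hu⟩ : P)⁻¹ * ⟨g, hgP⟩ * ⟨u, hu⟩) * (⟨u, hu⟩ : P)⁻¹
      = ⟨g, hgP⟩ := by group
    rwa [e] at h4
  refine hM.1 (eq_top_iff.2 fun g _ => ?_)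
  obtain ⟨m, hm, hmg⟩ := hle g.2
  rwa [← Subtype.ext hmg]

theorem Multiset.card_mul_eq_sum_of_norm_sum_eq_card {s : Multiset ℂ} (h : ∀ z ∈ s, ‖z‖ = 1)
    (hs : ‖s.sum‖ = s.card) : ∀ z ∈ s, (s.card : ℂ) * z = s.sum := by
  intro z hz
  set S := s.sum with hS
  have hle : ∀ w ∈ s, (starRingEnd ℂ S * w).re ≤ s.card := fun w hw =>
    (Complex.re_le_norm _).trans (by rw [norm_mul, Complex.norm_conj, h w hw, hs, mul_one])
  have hsum : (s.map fun w => (starRingEnd ℂ S * w).re).sum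
      = (s.map fun _ => (s.card : ℝ)).sum := by
    have h1 : (s.map fun w => (starRingEnd ℂ S * w).re).sum = (starRingEnd ℂ S * S).re := by
      have h2 : (s.map fun w => starRingEnd ℂ S * w).sum = starRingEnd ℂ S * S := by
        rw [Multiset.sum_map_mul_left, Multiset.map_id']
      rw [← h2]
      exact Multiset.sum_hom' s Complex.reAddGroupHom fun w => starRingEnd ℂ S * w
    rw [h1, mul_comm, Complex.mul_conj, Complex.normSq_eq_norm_sq, hs]
    simp [sq]
  have heq : (starRingEnd ℂ S * z).re = s.card := by
    by_contra hne
    exact (Multiset.sum_lt_sum hle ⟨z, hz, lt_of_le_of_ne (hle z hz) hne⟩).ne hsum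
  have hz1 : z.re * z.re + z.im * z.im = 1 := by
    rw [← Complex.normSq_apply, Complex.normSq_eq_norm_sq, h z hz, one_pow]
  have hS1 : S.re * S.re + S.im * S.im = s.card * s.card := by
    rw [← Complex.normSq_apply, Complex.normSq_eq_norm_sq, hs, sq]
  simp only [Complex.mul_re, Complex.conj_re, Complex.conj_im] at heq
  have h2 : (s.card * z.re - S.re) ^ 2 + (s.card * z.im - S.im) ^ 2 = 0 := by
    linear_combination (s.card : ℝ) ^ 2 * hz1 + hS1 - 2 * (s.card : ℝ) * heq
  have h3 : s.card * z.re - S.re = 0 := by nlinarith [sq_nonneg (s.card * z.im - S.im)]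
  have h4 : s.card * z.im - S.im = 0 := by nlinarith [sq_nonneg (s.card * z.re - S.re)]
  apply Complex.ext <;> simp <;> linarith

theorem Matrix.roots_charpoly_pow_eq_one {k : Type*} [Field k] {n m : ℕ}
    {M : Matrix (Fin n) (Fin n) k} (hM : M ^ m = 1) {r : k} (hr : r ∈ M.charpoly.roots) :
    r ^ m = 1 := by
  have h1 : r ∈ spectrum k M :=
    Matrix.mem_spectrum_iff_isRoot_charpoly.2 (Polynomial.isRoot_of_mem_roots hr)
  have h2 := spectrum.pow_mem_pow M m h1
  rw [hM] at h2
  have : Nontrivial (Matrix (Fin n) (Fin n) k) := by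
    by_contra hn
    rw [not_nontrivial_iff_subsingleton] at hn
    rw [spectrum.of_subsingleton] at h1
    exact h1
  rwa [spectrum.one_eq, Set.mem_singleton_iff] at h2

theorem Matrix.eq_scalar_of_pow_eq_one_of_roots_eq {k : Type*} [Field k] [CharZero k]
    [IsAlgClosed k] {n m : ℕ} (hm : 0 < m) {M : Matrix (Fin n) (Fin n) k} (hM : M ^ m = 1)
    {c : k} (hc : ∀ r ∈ M.charpoly.roots, r = c) : M = Matrix.scalar (Fin n) c := by
  have hchar : M.charpoly = (Polynomial.X - Polynomial.C c) ^ n := by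
    rw [(IsAlgClosed.splits M.charpoly).eq_prod_roots_of_monic M.charpoly_monic,
      Multiset.eq_replicate_of_mem hc, Multiset.map_replicate, Multiset.prod_replicate,
      ← (IsAlgClosed.splits M.charpoly).natDegree_eq_card_roots, M.charpoly_natDegree_eq_dim,
      Fintype.card_fin]
  have hsq : Squarefree (minpoly k M) := by
    have : NeZero (m : k) := ⟨by exact_mod_cast hm.ne'⟩
    refine Squarefree.squarefree_of_dvd (minpoly.dvd k M (p := Polynomial.X ^ m - 1) (by simp [hM]))
      (Polynomial.Separable.squarefree ?_)
    rw [Polynomial.X_pow_sub_one_separable_iff]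
    exact_mod_cast hm.ne'
  have hdvd : minpoly k M ∣ Polynomial.X - Polynomial.C c :=
    hsq.isRadical n _ (hchar ▸ M.minpoly_dvd_charpoly)
  have := (minpoly.dvd_iff).1 hdvd
  rw [map_sub, Polynomial.aeval_X, Polynomial.aeval_C, sub_eq_zero] at this
  exact this

theorem Matrix.trace_eq_zero_or_eq_scalar {k : Type*} [Field k] [CharZero k] [IsAlgClosed k]
    [Algebra.IsAlgebraic ℚ k] {n m : ℕ} (hm : 0 < m) {M : Matrix (Fin n) (Fin n) k}
    (hM : M ^ m = 1) (hint : IsIntegral ℤ (M.trace / n)) :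
    M.trace = 0 ∨ ∃ c, M = Matrix.scalar (Fin n) c := by
  by_cases h0 : M.trace = 0
  · exact Or.inl h0
  right
  have hn : n ≠ 0 := by
    rintro rfl
    exact h0 (by simp [Matrix.trace])
  set α := M.trace / n with hα
  have hα0 : α ≠ 0 := div_ne_zero h0 (by exact_mod_cast hn)
  have htr : M.trace = n * α := by rw [hα, mul_div_cancel₀ _ (by exact_mod_cast hn)]
  have hcard : M.charpoly.roots.card = n := by
    rw [← (IsAlgClosed.splits M.charpoly).natDegree_eq_card_roots, M.charpoly_natDegree_eq_dim,
      Fintype.card_fin]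
  have hroot (τ : k →+* ℂ) : ∀ z ∈ M.charpoly.roots.map τ, ‖z‖ = 1 := by
    intro z hz
    obtain ⟨r, hr, rfl⟩ := Multiset.mem_map.1 hz
    have h1 : τ r ^ m = 1 := by
      rw [← map_pow, Matrix.roots_charpoly_pow_eq_one hM hr, map_one]
    exact Complex.norm_eq_one_of_pow_eq_one h1 hm.ne'
  have hsum (τ : k →+* ℂ) : (M.charpoly.roots.map τ).sum = n * τ α := by
    rw [Multiset.sum_hom, ← Matrix.trace_eq_sum_roots_charpoly, htr, map_mul, map_natCast]
  have hle (τ : k →+* ℂ) : ‖τ α‖ ≤ 1 := by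
    have h1 : ‖(M.charpoly.roots.map τ).sum‖ ≤ n := by
      refine (norm_multiset_sum_le _).trans ?_
      rw [Multiset.map_congr rfl (hroot τ)]
      simp [hcard]
    rw [hsum, norm_mul, Complex.norm_natCast] at h1
    have : (0 : ℝ) < n := by exact_mod_cast Nat.pos_of_ne_zero hn
    nlinarith
  have hαQ : IsIntegral ℚ α := Algebra.IsIntegral.isIntegral α
  have hpow : ∃ j, 0 < j ∧ α ^ j = 1 := by
    let K := IntermediateField.adjoin ℚ {α}
    have : FiniteDimensional ℚ K := IntermediateField.adjoin.finiteDimensional hαQ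
    have : NumberField K :=
      { to_charZero := inferInstance, to_finiteDimensional := by convert this }
    let x : K := IntermediateField.AdjoinSimple.gen ℚ α
    have hxα : (x : k) = α := IntermediateField.AdjoinSimple.coe_gen ℚ α
    have hx0 : x ≠ 0 := fun h => hα0 (by rw [← hxα, h]; rfl)
    have hxi : IsIntegral ℤ x := by
      rw [← isIntegral_algHom_iff (K.val.restrictScalars ℤ) K.val.injective]
      change IsIntegral ℤ (x : k)
      rwa [hxα]
    obtain ⟨j, hj, hxj⟩ := NumberField.Embeddings.pow_eq_one_of_norm_le_one K ℂ hx0 hxi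
      (fun φ => by
        let := φ.toAlgebra
        let τ : k →ₐ[K] ℂ := IsAlgClosed.lift
        have h1 : φ x = τ α := by
          rw [← hxα]
          exact (τ.commutes x).symm
        rw [h1]
        exact hle τ.toRingHom)
    refine ⟨j, hj, ?_⟩
    rw [← hxα]
    exact_mod_cast congrArg (Subtype.val) hxj
  obtain ⟨j, hj, hαj⟩ := hpow
  let τ : k →ₐ[ℚ] ℂ := IsAlgClosed.lift
  refine ⟨α, Matrix.eq_scalar_of_pow_eq_one_of_roots_eq hm hM fun r hr => τ.injective ?_⟩
  have hτα : ‖τ α‖ = 1 :=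
    Complex.norm_eq_one_of_pow_eq_one (by rw [← map_pow, hαj, map_one]) hj.ne'
  have h1 := Multiset.card_mul_eq_sum_of_norm_sum_eq_card (hroot τ.toRingHom)
    (by
      rw [hsum, norm_mul, Complex.norm_natCast, Multiset.card_map, hcard]
      exact (congrArg _ hτα).trans (mul_one _)) _
    (Multiset.mem_map_of_mem _ hr)
  rw [hsum, Multiset.card_map, hcard] at h1
  exact mul_left_cancel₀ (by exact_mod_cast hn) h1

theorem LinearMap.trace_eq_sum_repr {R M ι : Type*} [CommRing R] [AddCommGroup M] [Module R M]
    [Fintype ι] (b : Module.Basis ι R M) (f : M →ₗ[R] M) :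
    LinearMap.trace R M f = ∑ i, b.repr (f (b i)) i := by
  classical
  rw [LinearMap.trace_eq_matrix_trace R b, Matrix.trace]
  exact Finset.sum_congr rfl fun i _ => LinearMap.toMatrix_apply _ _ _ _ _

theorem MonoidAlgebra.trace_mulLeft_of {k G : Type*} [Field k] [Group G] [Fintype G]
    [DecidableEq G] (g : G) :
    LinearMap.trace k (MonoidAlgebra k G) (LinearMap.mulLeft k (MonoidAlgebra.of k G g))
      = if g = 1 then (Fintype.card G : k) else 0 := by
  rw [LinearMap.trace_eq_sum_repr (MonoidAlgebra.basis G k)]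
  have h (x : G) : (MonoidAlgebra.basis G k).repr
      (LinearMap.mulLeft k (MonoidAlgebra.of k G g) (MonoidAlgebra.basis G k x)) x
      = if g = 1 then 1 else 0 := by
    have hb : MonoidAlgebra.basis G k x = MonoidAlgebra.single x 1 := rfl
    rw [LinearMap.mulLeft_apply, hb, MonoidAlgebra.of_apply, MonoidAlgebra.single_mul_single,
      mul_one]
    change (Finsupp.single (g * x) (1 : k)) x = _
    rw [Finsupp.single_apply]
    simp
  simp only [h]
  split_ifs <;> simp

theorem AlgEquiv.trace_mulLeft_eq_sum_matrix_trace {k R ι : Type*} [Field k] [Ring R] [Algebra k R]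
    [Fintype ι] {d : ι → ℕ} (e : R ≃ₐ[k] Π i, Matrix (Fin (d i)) (Fin (d i)) k) (a : R) :
    LinearMap.trace k R (LinearMap.mulLeft k a) = ∑ i, (d i : k) * (e a i).trace := by
  classical
  let b := (Pi.basis fun i => Matrix.stdBasis k (Fin (d i)) (Fin (d i))).map e.symm.toLinearEquiv
  rw [LinearMap.trace_eq_sum_repr b, Fintype.sum_sigma]
  refine Finset.sum_congr rfl fun i _ => ?_
  have h (x y : Fin (d i)) : b.repr (LinearMap.mulLeft k a (b ⟨i, (x, y)⟩)) ⟨i, (x, y)⟩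
      = e a i x x := by
    simp only [b, Module.Basis.map_repr, Module.Basis.map_apply, LinearEquiv.trans_apply,
      LinearMap.mulLeft_apply, Pi.basis_apply, Matrix.stdBasis_eq_single, Pi.basis_repr]
    have : (e.symm.toLinearEquiv.symm (a * e.symm.toLinearEquiv
        (Pi.single i (Matrix.single x y 1))) : Π i, Matrix (Fin (d i)) (Fin (d i)) k)
        = e a * Pi.single i (Matrix.single x y 1) := by
      change e (a * e.symm _) = _
      rw [map_mul, AlgEquiv.apply_symm_apply]
    rw [this, Pi.mul_apply, Pi.single_eq_same]
    change (e a i * Matrix.single x y 1 : Matrix (Fin (d i)) (Fin (d i)) k) x y = _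
    simp
  rw [Fintype.sum_prod_type]
  simp only [h]
  simp [Matrix.trace, Finset.mul_sum]

theorem MonoidAlgebra.exists_algHom_matrix (k G : Type*) [Field k] [CharZero k] [IsAlgClosed k]
    [Group G] [Fintype G] [DecidableEq G] :
    ∃ (N : ℕ) (d : Fin N → ℕ)
      (φ : ∀ i, MonoidAlgebra k G →ₐ[k] Matrix (Fin (d i)) (Fin (d i)) k),
      (∀ i, d i ≠ 0) ∧ (∀ i, Function.Surjective (φ i)) ∧
      ∀ g, ∑ i, (d i : k) * (φ i (MonoidAlgebra.of k G g)).trace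
        = if g = 1 then (Fintype.card G : k) else 0 := by
  obtain ⟨N, d, hd, ⟨e⟩⟩ :=
    IsSemisimpleRing.exists_algEquiv_pi_matrix_of_isAlgClosed k (MonoidAlgebra k G)
  refine ⟨N, d, fun i => (Pi.evalAlgHom k _ i).comp e.toAlgHom, fun i => (hd i).out,
    fun i => (Function.surjective_eval i).comp e.surjective, fun g => ?_⟩
  rw [← MonoidAlgebra.trace_mulLeft_of, e.trace_mulLeft_eq_sum_matrix_trace]
  rfl

theorem Matrix.trace_scalar_fin {k : Type*} [CommRing k] (n : ℕ) (c : k) :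
    (Matrix.scalar (Fin n) c).trace = n * c := by
  simp [Matrix.trace]

theorem Matrix.exists_eq_scalar_of_commute_range {k R : Type*} [Field k] [Ring R] [Algebra k R]
    {n : ℕ} {φ : R →ₐ[k] Matrix (Fin n) (Fin n) k} (hφ : Function.Surjective φ) {z : R}
    (hz : ∀ a, a * z = z * a) : ∃ c, φ z = Matrix.scalar (Fin n) c := by
  have : φ z ∈ Set.center (Matrix (Fin n) (Fin n) k) := by
    rw [Semigroup.mem_center_iff]
    intro b
    obtain ⟨a, rfl⟩ := hφ b
    rw [← map_mul, hz, map_mul]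
  rw [Matrix.center_eq_range] at this
  obtain ⟨c, hc⟩ := this
  exact ⟨c, hc.symm⟩

theorem MonoidAlgebra.commute_of_forall_of {k G : Type*} [Field k] [Group G]
    {z : MonoidAlgebra k G}
    (hz : ∀ g, MonoidAlgebra.of k G g * z = z * MonoidAlgebra.of k G g) (a : MonoidAlgebra k G) :
    a * z = z * a := by
  induction a using MonoidAlgebra.induction_on with
  | of g => exact hz g
  | add a b ha hb => rw [add_mul, mul_add, ha, hb]
  | smul r a ha => rw [smul_mul_assoc, mul_smul_comm, ha]

/-- A finite group has, besides a single one-dimensional trivial one, only nontrivial irreducible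
matrix representations, and these satisfy the second orthogonality relation with the identity. -/
theorem MonoidAlgebra.exists_nontrivial_algHom_matrix (k G : Type*) [Field k] [CharZero k]
    [IsAlgClosed k] [Group G] [Fintype G] :
    ∃ (N : ℕ) (s : Finset (Fin N)) (d : Fin N → ℕ)
      (φ : ∀ i, MonoidAlgebra k G →ₐ[k] Matrix (Fin (d i)) (Fin (d i)) k),
      (∀ i, d i ≠ 0) ∧ (∀ i, Function.Surjective (φ i)) ∧
      (∀ i ∈ s, ∃ g, φ i (MonoidAlgebra.of k G g) ≠ 1) ∧
      ∀ g, g ≠ 1 → 1 + ∑ i ∈ s, (d i : k) * (φ i (MonoidAlgebra.of k G g)).trace = 0 := by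
  classical
  obtain ⟨N, d, φ, hd, hφ, htr⟩ := MonoidAlgebra.exists_algHom_matrix k G
  have hG : (Fintype.card G : k) ≠ 0 := by exact_mod_cast Fintype.card_ne_zero
  let z : MonoidAlgebra k G := ∑ g, MonoidAlgebra.of k G g
  have hzl (g : G) : MonoidAlgebra.of k G g * z = z := by
    simp only [z, Finset.mul_sum, ← map_mul]
    exact Fintype.sum_equiv (Equiv.mulLeft g) _ _ fun _ => rfl
  have hzr (g : G) : z * MonoidAlgebra.of k G g = z := by
    simp only [z, Finset.sum_mul, ← map_mul]
    exact Fintype.sum_equiv (Equiv.mulRight g) _ _ fun _ => rfl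
  have hzz : z * z = (Fintype.card G : k) • z := by
    conv_lhs => enter [1]; unfold z
    rw [Finset.sum_mul, Finset.sum_congr rfl fun g _ => hzl g]
    simp [Nat.cast_smul_eq_nsmul]
  choose c hc using fun i => Matrix.exists_eq_scalar_of_commute_range (hφ i)
    (MonoidAlgebra.commute_of_forall_of fun g => (hzl g).trans (hzr g).symm)
  have hscalar {i} {x y : k} (h : Matrix.scalar (Fin (d i)) x = Matrix.scalar (Fin (d i)) y) :
      x = y := by
    have : Nonempty (Fin (d i)) := ⟨⟨0, Nat.pos_of_ne_zero (hd i)⟩⟩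
    exact Matrix.scalar_inj.1 h
  have hcc (i) : c i = 0 ∨ c i = Fintype.card G := by
    have h := congrArg (φ i) hzz
    rw [map_mul, map_smul, hc, ← map_mul, Matrix.smul_eq_diagonal_mul] at h
    have h2 : c i * c i = Fintype.card G * c i := hscalar (by rw [h, map_mul]; rfl)
    rcases eq_or_ne (c i) 0 with h0 | h0
    · exact Or.inl h0
    · exact Or.inr (mul_right_cancel₀ h0 h2)
  have hsum : ∑ i with c i ≠ 0, d i * d i = 1 := by
    have h1 : ∑ i, (d i : k) * (φ i z).trace = Fintype.card G := by
      have : ∀ i, (d i : k) * (φ i z).trace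
          = ∑ g, (d i : k) * (φ i (MonoidAlgebra.of k G g)).trace := by
        intro i
        rw [← Finset.mul_sum, ← Matrix.trace_sum, ← map_sum]
      rw [Finset.sum_congr rfl fun i _ => this i, Finset.sum_comm,
        Finset.sum_congr rfl fun g _ => htr g]
      simp
    have h2 (i) : (d i : k) * (φ i z).trace
        = if c i ≠ 0 then (d i * d i : k) * Fintype.card G else 0 := by
      rw [hc]
      rcases hcc i with h | h
      · simp [h]
      · rw [if_pos (h ▸ hG), h]
        rw [Matrix.trace_scalar_fin, mul_assoc]
    rw [Finset.sum_congr rfl fun i _ => h2 i, ← Finset.sum_filter, ← Finset.sum_mul] at h1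
    have h3 := mul_right_cancel₀ hG (h1.trans (one_mul _).symm)
    exact_mod_cast h3
  obtain ⟨i₀, hi₀⟩ : ∃ i, c i ≠ 0 := by
    by_contra! h
    simp [h] at hsum
  have hi₀' : i₀ ∈ Finset.univ.filter (fun i => c i ≠ 0) := by simpa using hi₀
  have hd1 : d i₀ = 1 := by
    have := Finset.single_le_sum (f := fun i => d i * d i) (fun i _ => Nat.zero_le _) hi₀'
    have h2 := Nat.pos_of_ne_zero (hd i₀)
    rw [hsum] at this
    nlinarith
  have huniq (i) (hi : i ≠ i₀) : c i = 0 := by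
    by_contra h
    rw [← Finset.add_sum_erase _ _ hi₀', hd1] at hsum
    have h1 : i ∈ (Finset.univ.filter (fun i => c i ≠ 0)).erase i₀ := by simp [hi, h]
    have := Finset.single_le_sum (f := fun i => d i * d i) (fun i _ => Nat.zero_le _) h1
    have h2 := Nat.pos_of_ne_zero (hd i)
    nlinarith
  refine ⟨N, Finset.univ.erase i₀, d, φ, hd, hφ, fun i hi => ?_, fun g hg => ?_⟩
  · by_contra! h
    have h1 : φ i z = Fintype.card G • 1 := by
      simp only [z, map_sum, h]
      simp
    rw [hc, huniq i (Finset.ne_of_mem_erase hi)] at h1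
    have h2 : (0 : k) = Fintype.card G := hscalar (i := i) (by
      rw [h1, map_natCast, nsmul_eq_mul, mul_one])
    exact hG h2.symm
  · have h1 : φ i₀ (MonoidAlgebra.of k G g) = 1 := by
      have h2 := congrArg (φ i₀) (hzl g)
      rw [map_mul, hc, (hcc i₀).resolve_left hi₀, map_natCast] at h2
      have h3 : (Fintype.card G : k) • φ i₀ (MonoidAlgebra.of k G g)
          = (Fintype.card G : k) • 1 := by
        rw [Nat.cast_smul_eq_nsmul, Nat.cast_smul_eq_nsmul, nsmul_eq_mul, nsmul_eq_mul, mul_one,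
          Nat.cast_comm]
        exact h2
      exact smul_right_injective _ hG h3
    have h4 := htr g
    rw [if_neg hg, ← Finset.add_sum_erase _ _ (Finset.mem_univ i₀), h1] at h4
    simpa [Matrix.trace_one, hd1] using h4

theorem Matrix.isIntegral_trace_of_pow_eq_one {k : Type*} [Field k] [IsAlgClosed k] {n m : ℕ}
    (hm : 0 < m) {M : Matrix (Fin n) (Fin n) k} (hM : M ^ m = 1) : IsIntegral ℤ M.trace := by
  rw [Matrix.trace_eq_sum_roots_charpoly]
  refine multiset_sum_mem (S := integralClosure ℤ k) _ fun r hr => ?_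
  refine IsIntegral.of_pow hm ?_
  rw [Matrix.roots_charpoly_pow_eq_one hM hr]
  exact isIntegral_one

/-- **Burnside's lemma** on conjugacy classes of prime power order. -/
theorem exists_commute_algHom_matrix_of_card_isConj_eq_prime_pow (k : Type*) [Field k] [CharZero k]
    [IsAlgClosed k] [Algebra.IsAlgebraic ℚ k] {G : Type*} [Group G] [Fintype G] {g : G}
    (hg : g ≠ 1) {p m : ℕ} (hp : p.Prime) (hcard : {x | IsConj g x}.ncard = p ^ m) :
    ∃ (n : ℕ) (φ : G →* Matrix (Fin n) (Fin n) k),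
      (∃ x, φ x ≠ 1) ∧ ∀ x, φ g * φ x = φ x * φ g := by
  classical
  obtain ⟨N, s, d, φ, hd, hφ, hnt, htr⟩ := MonoidAlgebra.exists_nontrivial_algHom_matrix k G
  have htr := htr g hg
  have hpow (i) : (φ i (MonoidAlgebra.of k G g)) ^ Fintype.card G = 1 := by
    rw [← map_pow, ← map_pow, pow_card_eq_one, map_one, map_one]
  let C : Finset G := Finset.univ.filter fun x => IsConj g x
  have hC : C.card = p ^ m := by
    rw [← hcard, ← Set.ncard_coe_finset]
    congr 1
    ext x
    simp only [C, Finset.coe_filter, Finset.mem_univ, true_and]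
  let z : MonoidAlgebra k G := ∑ x ∈ C, MonoidAlgebra.of k G x
  have hzcomm (y : G) : MonoidAlgebra.of k G y * z = z * MonoidAlgebra.of k G y := by
    simp only [z, Finset.mul_sum, Finset.sum_mul, ← map_mul]
    refine Finset.sum_equiv (MulAut.conj y).toEquiv (fun x => ?_) (fun x _ => ?_)
    · simp only [C, Finset.mem_filter, Finset.mem_univ, true_and]
      have : IsConj x (y * x * y⁻¹) := isConj_iff.2 ⟨y, rfl⟩
      exact ⟨fun h => h.trans this, fun h => h.trans this.symm⟩
    · simp
  have hzint : IsIntegral ℤ z := by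
    let w : MonoidAlgebra ℤ G := ∑ x ∈ C, MonoidAlgebra.of ℤ G x
    have hw : MonoidAlgebra.mapRingHom G (Int.castRingHom k) w = z := by
      simp [w, z]
    rw [← hw]
    exact (Algebra.IsIntegral.isIntegral (R := ℤ) w).map
      (MonoidAlgebra.mapRingHom G (Int.castRingHom k)).toIntAlgHom
  have key (i) (hi : ¬ p ∣ d i) :
      IsIntegral ℤ ((φ i (MonoidAlgebra.of k G g)).trace / d i) := by
    obtain ⟨c, hc⟩ := Matrix.exists_eq_scalar_of_commute_range (hφ i)
      (MonoidAlgebra.commute_of_forall_of hzcomm)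
    have hcint : IsIntegral ℤ c := by
      have h1 : IsIntegral ℤ (Matrix.scalar (Fin (d i)) c) :=
        hc ▸ hzint.map ((φ i).toRingHom.toIntAlgHom)
      have : Nonempty (Fin (d i)) := ⟨⟨0, Nat.pos_of_ne_zero (hd i)⟩⟩
      exact (isIntegral_algHom_iff (Matrix.scalar (Fin (d i)) : k →+* _).toIntAlgHom
        (fun x y h => Matrix.scalar_inj.1 h)).1 h1
    have hct : (p : k) ^ m * (φ i (MonoidAlgebra.of k G g)).trace = d i * c := by
      have h1 : (φ i z).trace = d i * c := by
        rw [hc, Matrix.trace_scalar_fin]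
      rw [← h1, map_sum, Matrix.trace_sum]
      have h2 : ∀ x ∈ C, (φ i (MonoidAlgebra.of k G x)).trace
          = (φ i (MonoidAlgebra.of k G g)).trace := by
        intro x hx
        obtain ⟨y, rfl⟩ := isConj_iff.1 (Finset.mem_filter.1 hx).2
        rw [map_mul, map_mul, Matrix.trace_mul_comm, ← map_mul, ← map_mul, inv_mul_cancel_left]
      rw [Finset.sum_congr rfl h2, Finset.sum_const, hC]
      simp
    have hcop : IsCoprime ((p : ℤ) ^ m) (d i : ℤ) := by
      exact IsCoprime.pow_left
        (Nat.isCoprime_iff_coprime.2 ((Nat.Prime.coprime_iff_not_dvd hp).2 hi))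
    obtain ⟨u, v, huv⟩ := hcop
    have huv' : (u : k) * (p : k) ^ m + v * d i = 1 := by
      have h := congrArg (Int.cast (R := k)) huv
      push_cast at h
      exact h
    have hdk : (d i : k) ≠ 0 := by exact_mod_cast hd i
    have h3 : (φ i (MonoidAlgebra.of k G g)).trace / d i
        = u * c + v * (φ i (MonoidAlgebra.of k G g)).trace := by
      rw [div_eq_iff hdk]
      linear_combination (-(φ i (MonoidAlgebra.of k G g)).trace) * huv' + u * hct
    rw [h3]
    have hZ (u : ℤ) : IsIntegral ℤ (u : k) := isIntegral_algebraMap (R := ℤ) (x := u)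
    exact ((hZ u).mul hcint).add
      ((hZ v).mul (Matrix.isIntegral_trace_of_pow_eq_one Fintype.card_pos (hpow i)))
  by_contra! hno
  have hterm : ∀ i ∈ s, ∃ w : k, IsIntegral ℤ w ∧
      (d i : k) * (φ i (MonoidAlgebra.of k G g)).trace = p * w := by
    intro i hi
    by_cases hpd : p ∣ d i
    · obtain ⟨q, hq⟩ := hpd
      refine ⟨q * (φ i (MonoidAlgebra.of k G g)).trace, IsIntegral.mul ?_
        (Matrix.isIntegral_trace_of_pow_eq_one Fintype.card_pos (hpow i)), ?_⟩
      · exact_mod_cast isIntegral_algebraMap (R := ℤ) (A := k) (x := q)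
      · have hqk : (d i : k) = p * q := by exact_mod_cast congrArg (Nat.cast (R := k)) hq
        rw [hqk, mul_assoc]
    · refine ⟨0, isIntegral_zero, ?_⟩
      rcases Matrix.trace_eq_zero_or_eq_scalar Fintype.card_pos (hpow i) (key i hpd) with h | ⟨c, h⟩
      · rw [h, mul_zero, mul_zero]
      · obtain ⟨x, hx⟩ := hno (d i) ((φ i : _ →* _).comp (MonoidAlgebra.of k G)) (hnt i hi)
        refine absurd ?_ hx
        change φ i (MonoidAlgebra.of k G g) * _ = _ * φ i (MonoidAlgebra.of k G g)
        rw [h]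
        exact Matrix.scalar_commute c (Commute.all c) _
  choose! w hw1 hw2 using hterm
  rw [Finset.sum_congr rfl hw2, ← Finset.mul_sum] at htr
  have hp0 : (p : k) ≠ 0 := by exact_mod_cast hp.ne_zero
  have hint : IsIntegral ℤ (∑ i ∈ s, w i) := IsIntegral.sum _ hw1
  have heq : ∑ i ∈ s, w i = algebraMap ℚ k (-1 / p) := by
    rw [map_div₀, map_neg, map_one, map_natCast, eq_div_iff hp0]
    linear_combination htr
  rw [heq, isIntegral_algebraMap_iff (algebraMap ℚ k).injective] at hint
  obtain ⟨a, ha⟩ := IsIntegrallyClosed.isIntegral_iff.1 hint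
  have hpq : (p : ℚ) ≠ 0 := by exact_mod_cast hp.ne_zero
  rw [eq_div_iff hpq, eq_intCast] at ha
  have h1 : a * p = -1 := by exact_mod_cast ha
  have h2 : (p : ℤ) ∣ 1 := ⟨-a, by linarith⟩
  exact hp.one_lt.ne' (Nat.dvd_one.1 (by exact_mod_cast h2))

theorem AlgebraicClosure.isAlgebraic_rat : Algebra.IsAlgebraic ℚ (AlgebraicClosure ℚ) := by
  have h : (DivisionRing.toRatAlgebra : Algebra ℚ (AlgebraicClosure ℚ)) =
      AlgebraicClosure.instAlgebra ℚ := Subsingleton.elim _ _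
  rw [h]
  exact AlgebraicClosure.isAlgebraic ℚ

theorem Subgroup.ncard_isConj_dvd_index {G : Type*} [Group G] (H : Subgroup G) {z : G}
    (hz : ∀ h ∈ H, h * z = z * h) : {x | IsConj z x}.ncard ∣ H.index := by
  have h1 : {x | IsConj z x} = MulAction.orbit (ConjAct G) z := by
    ext x
    rw [ConjAct.mem_orbit_conjAct, Set.mem_ofPred_eq, isConj_comm]
  rw [h1, ← MulAction.index_stabilizer, ConjAct.stabilizer_eq_centralizer]
  have h2 : (H.comap ConjAct.ofConjAct.toMonoidHom).index = H.index :=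
    Subgroup.index_comap_of_surjective _ ConjAct.ofConjAct.surjective
  rw [← h2]
  refine Subgroup.index_dvd_of_le fun h hh => ?_
  rw [Subgroup.mem_centralizer_iff]
  rintro _ rfl
  exact (hz _ hh).symm

theorem Group.isSolvable_of_isSimpleGroup_of_card {G : Type*} [Group G] [Finite G]
    [IsSimpleGroup G] {p q a b : ℕ} (hp : p.Prime) (hq : q.Prime)
    (hG : Nat.card G = p ^ a * q ^ b) : Group.IsSolvable G := by
  have := Fact.mk hp
  have := Fact.mk hq
  let Q : Sylow q G := default
  have hQ : (Q : Subgroup G).index ∣ p ^ a :=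
    (((Nat.Prime.coprime_iff_not_dvd hq).2 Q.not_dvd_index).symm.pow_right b).dvd_of_dvd_mul_right
      (hG ▸ Subgroup.index_dvd_card _)
  rcases eq_or_ne (Q : Subgroup G) ⊥ with hbot | hbot
  · rw [hbot, Subgroup.index_bot] at hQ
    obtain ⟨m, -, hm⟩ := (Nat.dvd_prime_pow hp).1 hQ
    have := (IsPGroup.of_card hm).isNilpotent
    infer_instance
  have : Nontrivial Q := (Subgroup.nontrivial_iff_ne_bot _).2 hbot
  have := Q.isPGroup'.center_nontrivial
  obtain ⟨⟨⟨z, hzQ⟩, hzc⟩, hz1⟩ := exists_ne (1 : Subgroup.center Q)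
  have hz : ∀ h ∈ (Q : Subgroup G), h * z = z * h := fun h hh =>
    congrArg Subtype.val (Subgroup.mem_center_iff.1 hzc ⟨h, hh⟩)
  have hz1 : z ≠ 1 := fun h => hz1 (by ext; exact h)
  obtain ⟨m, -, hm⟩ := (Nat.dvd_prime_pow hp).1 ((Subgroup.ncard_isConj_dvd_index _ hz).trans hQ)
  have := AlgebraicClosure.isAlgebraic_rat
  have := Fintype.ofFinite G
  obtain ⟨n, φ, ⟨x, hx⟩, hφ⟩ :=
    exists_commute_algHom_matrix_of_card_isConj_eq_prime_pow (AlgebraicClosure ℚ) hz1 hp hm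
  have hker : φ.ker = ⊥ := by
    refine (IsSimpleGroup.eq_bot_or_eq_top_of_normal φ.ker inferInstance).resolve_right fun h => ?_
    exact hx (φ.mem_ker.1 (h ▸ Subgroup.mem_top x))
  have hzcenter : z ∈ Subgroup.center G := by
    refine Subgroup.mem_center_iff.2 fun y => ?_
    have : z * y * (y * z)⁻¹ ∈ φ.ker := by
      rw [φ.mem_ker, map_mul, map_mul, hφ, ← map_mul, ← map_mul, mul_inv_cancel, map_one]
    rw [hker, Subgroup.mem_bot, mul_inv_eq_one] at this
    exact this.symm
  have hcenter : Subgroup.center G = ⊤ :=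
    (IsSimpleGroup.eq_bot_or_eq_top_of_normal _ inferInstance).resolve_left fun h =>
      hz1 (Subgroup.mem_bot.1 (h ▸ hzcenter))
  exact Group.isSolvable_of_comm fun a b =>
    (Subgroup.mem_center_iff.1 (hcenter ▸ Subgroup.mem_top b) a)

/-- **Burnside's theorem**: groups of order `p ^ a * q ^ b` are solvable. -/
theorem Group.isSolvable_of_card_eq_prime_pow_mul_prime_pow {p q : ℕ} (hp : p.Prime)
    (hq : q.Prime) {G : Type*} [Group G] [Finite G] {a b : ℕ}
    (hG : Nat.card G ∣ p ^ a * q ^ b) : Group.IsSolvable G := by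
  induction hn : Nat.card G using Nat.strong_induction_on generalizing G with
  | _ n ih =>
    subst hn
    by_cases hN : ∃ N : Subgroup G, N.Normal ∧ N ≠ ⊥ ∧ N ≠ ⊤
    · obtain ⟨N, hN, hbot, htop⟩ := hN
      have hc := N.card_mul_index
      rw [isSolvable_iff_subgroup_quotient N]
      have h1 : 1 < Nat.card N := N.one_lt_card_iff_ne_bot.2 hbot
      have h2 : 1 < N.index := by
        have := N.index_ne_zero_of_finite
        have := mt N.index_eq_one.1 htop
        omega
      refine ⟨ih _ ?_ ((Subgroup.card_subgroup_dvd_card N).trans hG) rfl,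
        ih _ ?_ ((Subgroup.card_quotient_dvd_card N).trans hG) rfl⟩
      · nlinarith
      · change N.index < _
        nlinarith
    · push Not at hN
      rcases subsingleton_or_nontrivial G with h | h
      · infer_instance
      have : IsSimpleGroup G := ⟨fun N hN' => or_iff_not_imp_left.2 (hN N hN')⟩
      obtain ⟨x, y, hx, hy, hxy⟩ := Nat.dvd_mul.1 hG
      obtain ⟨c, -, rfl⟩ := (Nat.dvd_prime_pow hp).1 hx
      obtain ⟨d, -, rfl⟩ := (Nat.dvd_prime_pow hq).1 hy
      exact Group.isSolvable_of_isSimpleGroup_of_card hp hq hxy.symm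

/-- A map from the free `ZMod N`-module on `Y` to the permutations of `Y` that satisfies the
cocycle identity; it turns that module into a group with an action on `Y`. -/
structure LinearCocycle (Y : Type*) (N : ℕ) where
  toFun : (Y → ZMod N) → Equiv.Perm Y
  toFun_add_comp : ∀ a b, toFun (a + b ∘ toFun a) = toFun b * toFun a

namespace LinearCocycle

variable {Y : Type*} {N : ℕ} (F : LinearCocycle Y N)

/-- The underlying set of the group defined by a cocycle. -/
@[ext]
structure Carrier (F : LinearCocycle Y N) where
  vec : Y → ZMod N

theorem toFun_zero : F.toFun 0 = 1 := by
  have h := F.toFun_add_comp 0 0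
  rw [Pi.zero_comp, add_zero] at h
  exact mul_eq_left.1 h.symm

instance : Mul F.Carrier := ⟨fun a b => ⟨a.vec + b.vec ∘ F.toFun a.vec⟩⟩

instance : One F.Carrier := ⟨⟨0⟩⟩

instance : Inv F.Carrier := ⟨fun a => ⟨-(a.vec ∘ (F.toFun a.vec).symm)⟩⟩

theorem vec_mul (a b : F.Carrier) : (a * b).vec = a.vec + b.vec ∘ F.toFun a.vec := rfl

theorem vec_one : (1 : F.Carrier).vec = 0 := rfl

theorem vec_inv (a : F.Carrier) : a⁻¹.vec = -(a.vec ∘ (F.toFun a.vec).symm) := rfl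

theorem toFun_vec_mul (a b : F.Carrier) :
    F.toFun (a * b).vec = F.toFun b.vec * F.toFun a.vec :=
  F.toFun_add_comp _ _

theorem carrier_mul_inv (a : F.Carrier) : a * a⁻¹ = 1 := by
  ext y
  simp [vec_mul, vec_one, vec_inv]

theorem toFun_vec_inv (a : F.Carrier) : F.toFun a⁻¹.vec = (F.toFun a.vec)⁻¹ := by
  rw [eq_inv_iff_mul_eq_one, ← toFun_vec_mul, carrier_mul_inv, vec_one, toFun_zero]

instance : Group F.Carrier where
  mul_assoc a b c := by
    ext y
    simp [vec_mul, toFun_add_comp, add_assoc]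
  one_mul a := by
    ext y
    simp [vec_mul, vec_one, toFun_zero]
  mul_one a := by
    ext y
    simp [vec_mul, vec_one]
  inv_mul_cancel a := by
    ext y
    rw [vec_mul, toFun_vec_inv]
    simp [vec_inv, vec_one]

instance : MulAction F.Carrier Y where
  smul a y := (F.toFun a.vec)⁻¹ y
  one_smul y := by
    change (F.toFun 0)⁻¹ y = y
    rw [toFun_zero]
    rfl
  mul_smul a b y := by
    change (F.toFun (a * b).vec)⁻¹ y = (F.toFun a.vec)⁻¹ ((F.toFun b.vec)⁻¹ y)
    rw [toFun_vec_mul, mul_inv_rev]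
    rfl

theorem smul_def (a : F.Carrier) (y : Y) : a • y = (F.toFun a.vec)⁻¹ y := rfl

/-- The bijection between the group of a cocycle and the underlying module. -/
def vecEquiv : F.Carrier ≃ (Y → ZMod N) := ⟨Carrier.vec, Carrier.mk, fun _ => rfl, fun _ => rfl⟩

instance [NeZero N] [Finite Y] : Finite F.Carrier := Finite.of_equiv _ F.vecEquiv.symm

/-- The elements of the group of a cocycle that are annihilated by `k`. -/
def torsion (k : ℕ) : Subgroup F.Carrier where
  carrier := {a | k • a.vec = 0}
  one_mem' := smul_zero k
  mul_mem' {a b} ha hb := by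
    have hb : k • b.vec = 0 := hb
    change k • (a.vec + b.vec ∘ F.toFun a.vec) = 0
    rw [smul_add, ← Pi.smul_comp, hb, Pi.zero_comp, add_zero]
    exact ha
  inv_mem' {a} ha := by
    have ha : k • a.vec = 0 := ha
    change k • -(a.vec ∘ (F.toFun a.vec).symm) = 0
    rw [smul_neg, ← Pi.smul_comp, ha, Pi.zero_comp, neg_zero]

theorem mem_torsion {k : ℕ} {a : F.Carrier} : a ∈ F.torsion k ↔ k • a.vec = 0 := Iff.rfl

theorem torsion_mono {k l : ℕ} (h : k ∣ l) : F.torsion k ≤ F.torsion l := by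
  obtain ⟨m, rfl⟩ := h
  intro a ha
  rw [mem_torsion] at ha ⊢
  rw [mul_comm, mul_smul, ha, smul_zero]

theorem torsion_self : F.torsion N = ⊤ := by
  refine (Subgroup.eq_top_iff' _).2 fun a => ?_
  rw [mem_torsion]
  ext y
  simp

theorem card_torsion [Finite Y] [NeZero N] {k : ℕ} (hk : k ∣ N) :
    Nat.card (F.torsion k) = k ^ Nat.card Y := by
  have e : F.torsion k ≃ (Y → (nsmulAddMonoidHom k : ZMod N →+ ZMod N).ker) :=
    { toFun := fun a y => ⟨a.1.vec y, congrFun a.2 y⟩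
      invFun := fun v => ⟨⟨fun y => v y⟩, funext fun y => (v y).2⟩
      left_inv := fun _ => rfl
      right_inv := fun _ => rfl }
  rw [Nat.card_congr e, Nat.card_fun, IsAddCyclic.card_nsmulAddMonoidHom_ker, Nat.card_zmod,
    Nat.gcd_eq_right hk]

theorem card_carrier [Finite Y] [NeZero N] : Nat.card F.Carrier = N ^ Nat.card Y := by
  rw [← F.card_torsion dvd_rfl, torsion_self, Subgroup.card_top]

theorem index_torsion_subgroupOf [Finite Y] [NeZero N] {k l : ℕ} (hl : k * l ∣ N) :
    ((F.torsion k).subgroupOf (F.torsion (k * l))).index = l ^ Nat.card Y := by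
  have hkl : 0 < k * l := Nat.pos_of_dvd_of_pos hl (NeZero.pos N)
  have h := ((F.torsion k).subgroupOf (F.torsion (k * l))).card_mul_index
  rw [Nat.card_congr (Subgroup.subgroupOfEquivOfLe (F.torsion_mono ⟨l, rfl⟩)).toEquiv,
    F.card_torsion hl, F.card_torsion ((Nat.dvd_mul_right k l).trans hl), mul_pow] at h
  exact Nat.eq_of_mul_eq_mul_left (pow_pos (Nat.pos_of_mul_pos_right hkl) _) h

theorem isSolvable_torsion [Finite Y] [NeZero N] {k : ℕ} (hk : k ∣ N) :
    Group.IsSolvable (F.torsion k) := by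
  induction k using Nat.strong_induction_on with
  | _ k ih =>
    have hk0 : k ≠ 0 := fun h => NeZero.ne N (Nat.eq_zero_of_zero_dvd (h ▸ hk))
    rcases le_or_gt k.primeFactors.card 2 with h2 | h2
    · obtain ⟨p, q, hp, hq, a, b, hab⟩ :
          ∃ p q : ℕ, p.Prime ∧ q.Prime ∧ ∃ a b, k = p ^ a * q ^ b := by
        have hf := Nat.prod_factorization_pow_eq_self hk0
        rw [Finsupp.prod, Nat.support_factorization] at hf
        interval_cases hc : k.primeFactors.card
        · rw [Finset.card_eq_zero.1 hc] at hf
          exact ⟨2, 2, Nat.prime_two, Nat.prime_two, 0, 0, hf.symm⟩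
        · obtain ⟨p, hp⟩ := Finset.card_eq_one.1 hc
          have hp' : p.Prime := Nat.prime_of_mem_primeFactors (n := k) (by simp [hp])
          rw [hp, Finset.prod_singleton] at hf
          exact ⟨p, p, hp', hp', k.factorization p, 0, by rw [hf, pow_zero, mul_one]⟩
        · obtain ⟨p, q, hpq, hp⟩ := Finset.card_eq_two.1 hc
          have hp' : p.Prime := Nat.prime_of_mem_primeFactors (n := k) (by simp [hp])
          have hq' : q.Prime := Nat.prime_of_mem_primeFactors (n := k) (by simp [hp])
          rw [hp, Finset.prod_pair hpq] at hf
          exact ⟨p, q, hp', hq', _, _, hf.symm⟩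
      refine Group.isSolvable_of_card_eq_prime_pow_mul_prime_pow hp hq (a := a * Nat.card Y)
        (b := b * Nat.card Y) ?_
      rw [F.card_torsion hk, pow_mul, pow_mul, ← mul_pow, ← hab]
    · obtain ⟨s, hs, hs3⟩ := Finset.exists_subset_card_eq (Nat.succ_le_of_lt h2)
      let r := (s.equivFinOfCardEq hs3).symm
      have hr (i) : (r i : ℕ).Prime := Nat.prime_of_mem_primeFactors (hs (r i).2)
      have hdvd (i) : (r i : ℕ) ∣ k := Nat.dvd_of_mem_primeFactors (hs (r i).2)
      have hk' (i) : ordCompl[(r i : ℕ)] k * ordProj[(r i : ℕ)] k = k := by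
        rw [mul_comm, Nat.ordProj_mul_ordCompl_eq_self]
      refine Group.isSolvable_of_coprime_index
        (fun i => (F.torsion (ordCompl[(r i : ℕ)] k)).subgroupOf (F.torsion k))
        (fun i => ?_) fun i j hij => ?_
      · have hdk : ordCompl[(r i : ℕ)] k ∣ k := Nat.ordCompl_dvd _ _
        have := ih _ (lt_of_le_of_ne (Nat.le_of_dvd (Nat.pos_of_ne_zero hk0) hdk)
          fun h => Nat.not_dvd_ordCompl (hr i) hk0 ((hdvd i).trans h.symm.dvd)) (hdk.trans hk)
        exact Group.isSolvable_of_surjective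
          (f := (Subgroup.subgroupOfEquivOfLe (F.torsion_mono hdk)).symm.toMonoidHom)
          (MulEquiv.surjective _)
      · have hindex (i) : ((F.torsion (ordCompl[(r i : ℕ)] k)).subgroupOf (F.torsion k)).index
            = (ordProj[(r i : ℕ)] k) ^ Nat.card Y := by
          have h := F.index_torsion_subgroupOf (k := ordCompl[(r i : ℕ)] k)
            (l := ordProj[(r i : ℕ)] k) (by rw [hk']; exact hk)
          rwa [hk'] at h
        change Nat.Coprime _ _
        rw [hindex, hindex]
        refine Nat.Coprime.pow _ _ (Nat.Coprime.pow _ _ ((Nat.coprime_primes (hr i) (hr j)).2 ?_))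
        exact fun h => hij (r.injective (Subtype.ext h))

theorem isSolvable_carrier [Finite Y] [NeZero N] : Group.IsSolvable F.Carrier := by
  have := F.isSolvable_torsion dvd_rfl
  rw [torsion_self] at this
  exact Group.isSolvable_of_surjective (f := (⊤ : Subgroup F.Carrier).subtype)
    fun a => ⟨⟨a, Subgroup.mem_top a⟩, rfl⟩

theorem torsion_le_closure [Finite Y] [DecidableEq Y]
    (hF : ∀ y m, F.toFun (Pi.single y m) y = y) (k : ℕ) :
    F.torsion k ≤ Subgroup.closure {g | g ∈ F.torsion k ∧ ∃ y : Y, g • y = y} := by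
  have := Fintype.ofFinite Y
  intro a ha
  have key (s : Finset Y) : (⟨∑ y ∈ s, Pi.single y (a.vec y)⟩ : F.Carrier) ∈
      Subgroup.closure {g | g ∈ F.torsion k ∧ ∃ y : Y, g • y = y} := by
    induction s using Finset.cons_induction with
    | empty => exact one_mem _
    | cons y s hy ih =>
      set v := ∑ y ∈ s, Pi.single y (a.vec y) with hv
      have h : (⟨∑ y ∈ s.cons y hy, Pi.single y (a.vec y)⟩ : F.Carrier)
          = ⟨v⟩ * ⟨Pi.single (F.toFun v y) (a.vec y)⟩ := by
        ext x
        rw [Finset.sum_cons, add_comm, vec_mul, ← hv]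
        simp [Pi.single_apply]
      rw [h]
      refine mul_mem ih (Subgroup.subset_closure ⟨?_, F.toFun v y, ?_⟩)
      · rw [mem_torsion, ← Pi.single_smul, ← Pi.smul_apply, F.mem_torsion.1 ha]
        simp
      · rw [smul_def, Equiv.Perm.inv_eq_iff_eq]
        exact (hF _ _).symm
  have h := key Finset.univ
  rwa [Finset.univ_sum_single] at h

theorem subsingleton_of_isPretransitive [Finite Y] [NeZero N] [DecidableEq Y]
    (hF : ∀ y m, F.toFun (Pi.single y m) y = y) [MulAction.IsPretransitive F.Carrier Y] :
    Subsingleton Y := by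
  by_contra hY
  rw [not_subsingleton_iff_nontrivial] at hY
  have := F.isSolvable_carrier
  obtain ⟨p, hp, hP⟩ := Group.IsSolvable.exists_sylow_closure_fixed_lt (G := F.Carrier) (X := Y)
  have := Fact.mk hp
  have hcard : Nat.card (F.torsion (ordProj[p] N))
      = p ^ (Nat.card F.Carrier).factorization p := by
    rw [F.card_torsion (Nat.ordProj_dvd N p), F.card_carrier, Nat.factorization_pow, ← pow_mul,
      Finsupp.smul_apply, smul_eq_mul, mul_comm]
  exact hP (Sylow.ofCard _ hcard) (F.torsion_le_closure hF _)

end LinearCocycle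

namespace CycleSet

variable {Y : Type*} {σ : Y → Equiv.Perm Y}

theorem leftCommutative (hσ : ∀ x y z, σ (σ x y) (σ x z) = σ (σ y x) (σ y z)) :
    LeftCommutative fun (x : Y) (g : Equiv.Perm Y) => σ (g x) * g :=
  ⟨fun x y g => Equiv.ext fun z => hσ (g y) (g x) (g z)⟩

/-- The permutation by which a multiset acts in a cycle set. -/
def multisetPerm (hσ : ∀ x y z, σ (σ x y) (σ x z) = σ (σ y x) (σ y z)) (s : Multiset Y) :
    Equiv.Perm Y :=
  haveI := leftCommutative hσ
  s.foldr (fun x g => σ (g x) * g) 1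

variable (hσ : ∀ x y z, σ (σ x y) (σ x z) = σ (σ y x) (σ y z))

theorem multisetPerm_zero : multisetPerm hσ 0 = 1 := rfl

theorem multisetPerm_cons (x : Y) (s : Multiset Y) :
    multisetPerm hσ (x ::ₘ s) = σ (multisetPerm hσ s x) * multisetPerm hσ s :=
  haveI := leftCommutative hσ
  Multiset.foldr_cons _ _ _ _

theorem multisetPerm_add (s t : Multiset Y) :
    multisetPerm hσ (s + t)
      = multisetPerm hσ (t.map (multisetPerm hσ s)) * multisetPerm hσ s := by
  induction t using Multiset.induction_on with
  | empty => rw [add_zero, Multiset.map_zero, multisetPerm_zero, one_mul]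
  | cons x t ih =>
    rw [Multiset.add_cons, Multiset.map_cons, multisetPerm_cons, multisetPerm_cons, ih, mul_assoc]
    rfl

theorem pow_apply_self {x : Y} (hx : σ x x = x) (k : ℕ) : (σ x ^ k) x = x := by
  induction k with
  | zero => rfl
  | succ k ih => rw [pow_succ, Equiv.Perm.mul_apply, hx, ih]

theorem multisetPerm_replicate {x : Y} (hx : σ x x = x) (k : ℕ) :
    multisetPerm hσ (Multiset.replicate k x) = σ x ^ k := by
  induction k with
  | zero => rfl
  | succ k ih => rw [Multiset.replicate_succ, multisetPerm_cons, ih, pow_apply_self hx, pow_succ']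

theorem multisetPerm_add_nsmul (hsq : ∀ x, σ x x = x) {N : ℕ} (hN : ∀ x, σ x ^ N = 1)
    (s t : Multiset Y) : multisetPerm hσ (s + N • t) = multisetPerm hσ s := by
  induction t using Multiset.induction_on with
  | empty => rw [smul_zero, add_zero]
  | cons x t ih =>
    rw [← Multiset.singleton_add, smul_add, add_comm (N • _), ← add_assoc, multisetPerm_add,
      Multiset.nsmul_singleton, Multiset.map_replicate, multisetPerm_replicate hσ (hsq _), hN,
      one_mul, ih]

theorem multisetPerm_congr [Finite Y] [DecidableEq Y] (hsq : ∀ x, σ x x = x) {N : ℕ}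
    (hN : ∀ x, σ x ^ N = 1) {s t : Multiset Y}
    (hst : ∀ y, (s.count y : ZMod N) = t.count y) : multisetPerm hσ s = multisetPerm hσ t := by
  have := Fintype.ofFinite Y
  have key (s : Multiset Y) :
      multisetPerm hσ s = multisetPerm hσ (∑ y, (s.count y % N) • {y}) := by
    conv_lhs => rw [show s = ∑ y, (s.count y % N) • {y} + N • ∑ y, (s.count y / N) • {y} by
      ext y
      simp [Multiset.count_sum', Multiset.count_singleton, Nat.mod_add_div]]
    rw [multisetPerm_add_nsmul hσ hsq hN]
  rw [key s, key t]
  congr! 3 with y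
  exact (ZMod.natCast_eq_natCast_iff' _ _ _).1 (hst y)

theorem exists_linearCocycle [Finite Y] [DecidableEq Y]
    (hσ : ∀ x y z, σ (σ x y) (σ x z) = σ (σ y x) (σ y z)) (hsq : ∀ x, σ x x = x) :
    ∃ N, NeZero N ∧ ∃ F : LinearCocycle Y N, (∀ x, F.toFun (Pi.single x 1) = σ x) ∧
      ∀ x m, F.toFun (Pi.single x m) x = x := by
  have := Fintype.ofFinite Y
  let N := Nat.card (Equiv.Perm Y)
  have hN (x) : σ x ^ N = 1 := pow_card_eq_one'
  have hN0 : NeZero N := ⟨Nat.card_pos.ne'⟩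
  let lift (a : Y → ZMod N) : Multiset Y := ∑ y, (a y).val • {y}
  have hlift (a y) : ((lift a).count y : ZMod N) = a y := by
    simp [lift, Multiset.count_sum', Multiset.count_singleton]
  have hsingle (x) (m : ZMod N) : multisetPerm hσ (lift (Pi.single x m)) = σ x ^ m.val := by
    rw [← multisetPerm_replicate hσ (hsq x)]
    refine multisetPerm_congr hσ hsq hN fun y => ?_
    rw [hlift, Multiset.count_replicate, Pi.single_apply]
    simp only [eq_comm (a := y)]
    split_ifs <;> simp
  refine ⟨N, hN0, ⟨fun a => multisetPerm hσ (lift a), fun a b => ?_⟩, fun x => ?_, fun x m => ?_⟩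
  · have h : multisetPerm hσ (lift b)
        = multisetPerm hσ ((lift (b ∘ multisetPerm hσ (lift a))).map (multisetPerm hσ (lift a))) := by
      refine multisetPerm_congr hσ hsq hN fun y => ?_
      obtain ⟨x, rfl⟩ := (multisetPerm hσ (lift a)).surjective y
      rw [Multiset.count_map_eq_count' _ _ (Equiv.injective _), hlift, hlift]
      rfl
    rw [h, ← multisetPerm_add]
    refine multisetPerm_congr hσ hsq hN fun y => ?_
    rw [Multiset.count_add, Nat.cast_add, hlift, hlift, hlift]
    rfl
  · change multisetPerm hσ (lift (Pi.single x 1)) = σ x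
    conv_rhs => rw [← pow_one (σ x), ← multisetPerm_replicate hσ (hsq x)]
    refine multisetPerm_congr hσ hsq hN fun y => ?_
    rw [hlift, Multiset.count_replicate, Pi.single_apply]
    simp only [eq_comm (a := y)]
    split_ifs <;> simp
  · change multisetPerm hσ (lift (Pi.single x m)) x = x
    rw [hsingle, pow_apply_self (hsq x)]

/-- **Rump's theorem**: a finite indecomposable square-free cycle set is trivial. -/
theorem subsingleton_of_indecomposable [Finite Y]
    (hσ : ∀ x y z, σ (σ x y) (σ x z) = σ (σ y x) (σ y z)) (hsq : ∀ x, σ x x = x)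
    (hind : ∀ B : Set Y, B.Nonempty → (∀ x y, y ∈ B ↔ σ x y ∈ B) → B = Set.univ) :
    Subsingleton Y := by
  classical
  obtain ⟨N, hN, F, hF1, hF⟩ := exists_linearCocycle hσ hsq
  have hsmul (x y) : (⟨Pi.single x 1⟩ : F.Carrier)⁻¹ • y = σ x y := by
    rw [inv_smul_eq_iff, F.smul_def, hF1]
    exact (Equiv.symm_apply_apply _ _).symm
  have : MulAction.IsPretransitive F.Carrier Y := by
    refine ⟨fun x y => ?_⟩
    have h := hind (MulAction.orbit F.Carrier x) (MulAction.nonempty_orbit x) fun u v => by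
      rw [← hsmul]
      exact ⟨MulAction.mem_orbit_of_mem_orbit _, fun h => by
        simpa using MulAction.mem_orbit_of_mem_orbit (⟨Pi.single u 1⟩ : F.Carrier) h⟩
    exact MulAction.mem_orbit_iff.1 (h ▸ Set.mem_univ y)
  exact F.subsingleton_of_isPretransitive hF

end CycleSet

namespace QCycleSet

variable {X : Type*} {σ δ : X → Equiv.Perm X}

theorem eq_univ_of_invariant
    (htrans : ∀ x y : X,
      ∃ g ∈ Subgroup.closure {g : Equiv.Perm X | ∃ x, g = σ x ∨ g = δ x}, g x = y)
    {B : Set X} (hB : B.Nonempty) (hσ : ∀ x y, y ∈ B ↔ σ x y ∈ B)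
    (hδ : ∀ x y, y ∈ B ↔ δ x y ∈ B) : B = Set.univ := by
  refine Set.eq_univ_of_forall fun y => ?_
  obtain ⟨x, hx⟩ := hB
  obtain ⟨g, hg, rfl⟩ := htrans x y
  suffices h : ∀ z, z ∈ B ↔ g z ∈ B from (h x).1 hx
  induction hg using Subgroup.closure_induction with
  | mem g hg =>
    obtain ⟨u, rfl | rfl⟩ := hg
    · exact hσ u
    · exact hδ u
  | one => exact fun _ => Iff.rfl
  | mul g h _ _ hg hh => exact fun z => (hh z).trans (hg (h z))
  | inv g _ hg => exact fun z => by rw [hg (g⁻¹ z), ← Equiv.Perm.mul_apply, mul_inv_cancel]; rfl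

theorem qcsRel_equivalence (k : ℕ) : Equivalence (qcsRel σ δ k) := by
  induction k with
  | zero => exact eq_equivalence
  | succ k ih =>
    exact ⟨fun x z => ⟨ih.refl _, ih.refl _⟩,
      fun h z => ⟨ih.symm (h z).1, ih.symm (h z).2⟩,
      fun h h' z => ⟨ih.trans (h z).1 (h' z).1, ih.trans (h z).2 (h' z).2⟩⟩

theorem qcsRel_congr
    (q1 : ∀ x y z : X, σ (σ x y) (σ x z) = σ (δ y x) (σ y z))
    (q2 : ∀ x y z : X, δ (δ x y) (δ x z) = δ (σ y x) (δ y z))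
    (q3 : ∀ x y z : X, δ (σ x y) (σ x z) = σ (δ y x) (δ y z)) {k : ℕ} {x x' y y' : X}
    (hx : qcsRel σ δ k x x') (hy : qcsRel σ δ k y y') :
    qcsRel σ δ k (σ x y) (σ x' y') ∧ qcsRel σ δ k (δ x y) (δ x' y') := by
  induction k generalizing x x' y y' with
  | zero =>
    obtain rfl : x = x' := hx
    obtain rfl : y = y' := hy
    exact ⟨rfl, rfl⟩
  | succ k ih =>
    have hk := qcsRel_equivalence (σ := σ) (δ := δ) k
    have hsucc {u v : X} (h : qcsRel σ δ k u v) : qcsRel σ δ (k + 1) u v :=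
      fun z => ih h (hk.refl z)
    refine ⟨(qcsRel_equivalence (k + 1)).trans (hsucc (hx y).1) fun z => ?_,
      (qcsRel_equivalence (k + 1)).trans (hsucc (hx y).2) fun z => ?_⟩
    · obtain ⟨w, rfl⟩ := (σ x').surjective z
      rw [q1, q1, q3, q3]
      exact ⟨(ih (hy x').2 (hy w).1).1, (ih (hy x').2 (hy w).2).1⟩
    · constructor
      · obtain ⟨w, rfl⟩ := (σ x').surjective z
        rw [← q1, ← q1]
        exact (ih (hy x').1 (hy w).1).1
      · obtain ⟨w, rfl⟩ := (δ x').surjective z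
        rw [q2, q2]
        exact (ih (hy x').1 (hy w).2).2

/-- A congruence modulo which the operations of a finite indecomposable square-free q-cycle set
coincide is total. -/
theorem rel_of_congr_of_rel_apply [Finite X]
    (q1 : ∀ x y z : X, σ (σ x y) (σ x z) = σ (δ y x) (σ y z))
    (htrans : ∀ x y : X,
      ∃ g ∈ Subgroup.closure {g : Equiv.Perm X | ∃ x, g = σ x ∨ g = δ x}, g x = y)
    (hsq : ∀ x : X, σ x x = x) (r : Setoid X)
    (hr : ∀ x x', r x x' → ∀ y y', r y y' → r (σ x y) (σ x' y'))
    (hδ : ∀ x y, r (σ x y) (δ x y)) (x y : X) : r x y := by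
  let op : Quotient r → Quotient r → Quotient r := Quotient.map₂ (fun x y => σ x y) hr
  have hop (q) : Function.Bijective (op q) := by
    refine Finite.surjective_iff_bijective.1 fun q' => ?_
    induction q, q' using Quotient.inductionOn₂ with
    | _ x y => exact ⟨⟦(σ x).symm y⟧, congrArg _ ((σ x).apply_symm_apply y)⟩
  have heq (x y : X) : (⟦σ x y⟧ : Quotient r) = ⟦δ x y⟧ := Quotient.sound (hδ x y)
  have : Subsingleton (Quotient r) := by
    refine CycleSet.subsingleton_of_indecomposable (σ := fun q => Equiv.ofBijective _ (hop q))
      (fun a b c => ?_) (fun a => ?_) fun B hB h => ?_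
    · induction a, b, c using Quotient.inductionOn₃ with
      | _ x y z =>
        change (⟦σ (σ x y) (σ x z)⟧ : Quotient r) = ⟦σ (σ y x) (σ y z)⟧
        rw [q1]
        exact Quotient.sound (hr _ _ (r.symm (hδ y x)) _ _ (r.refl _))
    · induction a using Quotient.inductionOn with
      | _ x => exact congrArg _ (hsq x)
    · have hu : (Quotient.mk r) ⁻¹' B = Set.univ :=
        eq_univ_of_invariant htrans (hB.preimage Quotient.mk_surjective)
          (fun x y => h ⟦x⟧ ⟦y⟧) fun x y => by
            rw [Set.mem_preimage, Set.mem_preimage, ← heq]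
            exact h ⟦x⟧ ⟦y⟧
      rw [Set.preimage_eq_univ_iff, Quotient.mk_surjective.range_eq] at hu
      exact Set.univ_subset_iff.1 hu
  exact Quotient.exact (Subsingleton.elim _ _)

theorem qcsRel_of_qcsRel_succ
    (htrans : ∀ x y : X,
      ∃ g ∈ Subgroup.closure {g : Equiv.Perm X | ∃ x, g = σ x ∨ g = δ x}, g x = y)
    (hsq : ∀ x : X, σ x x = x ∧ δ x x = x) {k : ℕ}
    (h : ∀ x y, qcsRel σ δ (k + 1) x y) (x y : X) : qcsRel σ δ k x y := by
  have hk := qcsRel_equivalence (σ := σ) (δ := δ) k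
  have hσ (u z : X) : qcsRel σ δ k (σ u z) z := by
    have := (h u z z).1
    rwa [(hsq z).1] at this
  have hδ (u z : X) : qcsRel σ δ k (δ u z) z := by
    have := (h u z z).2
    rwa [(hsq z).2] at this
  have hu : {z | qcsRel σ δ k x z} = Set.univ :=
    eq_univ_of_invariant htrans ⟨x, hk.refl x⟩
      (fun u z => ⟨fun h => hk.trans h (hk.symm (hσ u z)), fun h => hk.trans h (hσ u z)⟩)
      (fun u z => ⟨fun h => hk.trans h (hk.symm (hδ u z)), fun h => hk.trans h (hδ u z)⟩)
  exact hu.symm.subset (Set.mem_univ y)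

theorem not_forall_qcsRel [Nontrivial X]
    (htrans : ∀ x y : X,
      ∃ g ∈ Subgroup.closure {g : Equiv.Perm X | ∃ x, g = σ x ∨ g = δ x}, g x = y)
    (hsq : ∀ x : X, σ x x = x ∧ δ x x = x) (k : ℕ) : ¬ ∀ x y, qcsRel σ δ k x y := by
  induction k with
  | zero =>
    obtain ⟨x, y, hxy⟩ := exists_pair_ne X
    exact fun h => hxy (h x y)
  | succ k ih => exact fun h => ih (qcsRel_of_qcsRel_succ htrans hsq h)

/-- The operations of a finite indecomposable square-free q-cycle set do not coincide on any
iterated retract. -/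
theorem not_forall_qcsRel_apply [Finite X] [Nontrivial X]
    (q1 : ∀ x y z : X, σ (σ x y) (σ x z) = σ (δ y x) (σ y z))
    (q2 : ∀ x y z : X, δ (δ x y) (δ x z) = δ (σ y x) (δ y z))
    (q3 : ∀ x y z : X, δ (σ x y) (σ x z) = σ (δ y x) (δ y z))
    (htrans : ∀ x y : X,
      ∃ g ∈ Subgroup.closure {g : Equiv.Perm X | ∃ x, g = σ x ∨ g = δ x}, g x = y)
    (hsq : ∀ x : X, σ x x = x ∧ δ x x = x) (k : ℕ) :
    ¬ ∀ x y : X, qcsRel σ δ k (σ x y) (δ x y) := fun h =>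
  not_forall_qcsRel htrans hsq k
    (rel_of_congr_of_rel_apply q1 htrans (fun x => (hsq x).1) ⟨_, qcsRel_equivalence k⟩
      (fun _ _ hx _ _ hy => (qcsRel_congr q1 q2 q3 hx hy).1) h)

end QCycleSet

/-- In a finite indecomposable square-free q-cycle set, the two operations of
every iterated retraction Ret^k(X) do not coincide; in particular X is not
multipermutational. -/
theorem qcs_squarefree_ops_never_coincide {X : Type*} [Fintype X]
    (hX : 1 < Fintype.card X)
    (σ δ : X → Equiv.Perm X)
    (q1 : ∀ x y z : X, σ (σ x y) (σ x z) = σ (δ y x) (σ y z))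
    (q2 : ∀ x y z : X, δ (δ x y) (δ x z) = δ (σ y x) (δ y z))
    (q3 : ∀ x y z : X, δ (σ x y) (σ x z) = σ (δ y x) (δ y z))
    (htrans : ∀ x y : X,
      ∃ g ∈ Subgroup.closure {g : Equiv.Perm X | ∃ x, g = σ x ∨ g = δ x}, g x = y)
    (hsqfree : ∀ x : X, σ x x = x ∧ δ x x = x) :
    (∀ k : ℕ, ¬ ∀ x y : X, qcsRel σ δ k (σ x y) (δ x y)) ∧
    ¬ ∃ n : ℕ, ∀ x y : X, qcsRel σ δ n x y := by
  have := Fintype.one_lt_card_iff_nontrivial.1 hX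
  exact ⟨QCycleSet.not_forall_qcsRel_apply q1 q2 q3 htrans hsqfree,
    fun ⟨n, h⟩ => QCycleSet.not_forall_qcsRel htrans hsqfree n h⟩
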